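/- (Plugging in the new node) Suppose isBST t holds, subtree t p = some leaf, and insertableAt t p k holds. Then for every d : ℤ, replace t p (node leaf leaf k d) = some t' where isBST t' holds and Map t' = Map t † {k ↦ d} (as functions ℤ → Option ℤ). -/

import Mathlib

namespace ScopeLogicBST

/-- Binary trees whose nodes carry an integer key and integer data. -/
inductive T : Type where
  | leaf : T
  | node : T → T → ℤ → ℤ → T

/-- The key set of a tree. -/
def Dom : T → Finset ℤ
  | .leaf => ∅
  | .node l r K _ => {K} ∪ Dom l ∪ Dom r

/-- The finite map defined only at `K`, with value `D`. -/
def single (K D : ℤ) : ℤ → Option ℤ := fun k => if k = K then some D else none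

/-- Right-biased override of finite maps. -/
def ovr (M M' : ℤ → Option ℤ) : ℤ → Option ℤ := fun k =>
  match M' k with
  | some v => some v
  | none => M k

infixl:65 " † " => ovr

/-- The finite map retrieved from a tree. -/
def Map : T → ℤ → Option ℤ
  | .leaf => fun _ => none
  | .node l r K D => (single K D † Map l) † Map r

/-- Binary-search-tree property. -/
def isBST : T → Prop
  | .leaf => True
  | .node l r K _ =>
      isBST l ∧ isBST r ∧ (∀ k ∈ Dom l, k < K) ∧ (∀ k ∈ Dom r, K < k)

end ScopeLogicBST

namespace ScopeLogicBST

/-- Directions into a binary tree. -/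
inductive Dir : Type where
  | L : Dir
  | R : Dir

/-- The subtree of a tree at a given position, if any. -/
def subtree : T → List Dir → Option T
  | t, [] => some t
  | .leaf, _ :: _ => none
  | .node l _ _ _, .L :: p => subtree l p
  | .node _ r _ _, .R :: p => subtree r p

end ScopeLogicBST

namespace ScopeLogicBST

/-- The tree obtained from `t` by replacing the subtree at position `p` with `s`
(`none` when the position does not exist). -/
def replace : T → List Dir → T → Option T
  | _, [], s => some s
  | .leaf, _ :: _, _ => none
  | .node l r K D, .L :: p, s => (replace l p s).map (fun l' => T.node l' r K D)
  | .node l r K D, .R :: p, s => (replace r p s).map (fun r' => T.node l r' K D)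

/-- The position `p` exists in `t` and replacing the subtree there by a fresh node
carrying key `k` (and arbitrary data) always yields a binary search tree. -/
def insertableAt (t : T) (p : List Dir) (k : ℤ) : Prop :=
  (subtree t p).isSome ∧
    ∀ d : ℤ, ∃ t', replace t p (T.node .leaf .leaf k d) = some t' ∧ isBST t'

end ScopeLogicBST

open ScopeLogicBST

namespace ScopeLogicBST

theorem Map_eq_none_of_notMem_Dom {t : T} {x : ℤ} (hx : x ∉ Dom t) : Map t x = none := by
  induction t with
  | leaf => rfl
  | node l r K D ihl ihr =>
    simp only [Dom, Finset.mem_union, Finset.mem_singleton, not_or] at hx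
    simp [Map, ovr, single, hx.1.1, ihl hx.1.2, ihr hx.2]

theorem ovr_assoc (M₁ M₂ M₃ : ℤ → Option ℤ) : M₁ † M₂ † M₃ = M₁ † (M₂ † M₃) := by
  funext x
  simp only [ovr]
  cases M₃ x <;> rfl

theorem ovr_single_comm {M : ℤ → Option ℤ} {k : ℤ} (h : M k = none) (d : ℤ) :
    single k d † M = M † single k d := by
  funext x
  by_cases hx : x = k
  · subst hx
    simp [ovr, single, h]
  · simp only [ovr, single, if_neg hx]
    cases M x <;> rfl

theorem mem_Dom_of_replace {t t' s : T} {p : List Dir} {k : ℤ}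
    (h : replace t p s = some t') (hk : k ∈ Dom s) : k ∈ Dom t' := by
  induction t generalizing p t' with
  | leaf =>
    cases p with
    | nil => simp_all [replace]
    | cons a p => simp [replace] at h
  | node l r K D ihl ihr =>
    rcases p with _ | ⟨_ | _, p⟩
    · simp_all [replace]
    · simp only [replace, Option.map_eq_some_iff] at h
      obtain ⟨l', hl', rfl⟩ := h
      simp [Dom, ihl hl']
    · simp only [replace, Option.map_eq_some_iff] at h
      obtain ⟨r', hr', rfl⟩ := h
      simp [Dom, ihr hr']

theorem Map_of_replace_leaf {t t' : T} {p : List Dir} {k d : ℤ}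
    (hp : subtree t p = some T.leaf) (h : replace t p (T.node .leaf .leaf k d) = some t')
    (hbst : isBST t') : Map t' = Map t † single k d := by
  induction t generalizing p t' with
  | leaf =>
    cases p with
    | nil =>
      obtain rfl : T.node .leaf .leaf k d = t' := by simpa [replace] using h
      funext x
      simp only [Map, ovr]
      cases single k d x <;> rfl
    | cons a p => simp [replace] at h
  | node l r K D ihl ihr =>
    rcases p with _ | ⟨_ | _, p⟩
    · simp [subtree] at hp
    · simp only [replace, Option.map_eq_some_iff] at h
      obtain ⟨l', hl', rfl⟩ := h
      obtain ⟨hbl, -, hlt, hgt⟩ := hbst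
      have hkK : k < K := hlt k (mem_Dom_of_replace hl' (by simp [Dom]))
      have hkr : Map r k = none :=
        Map_eq_none_of_notMem_Dom fun hk => (hkK.trans (hgt k hk)).false
      simp only [Map, ihl hp hl' hbl, ovr_assoc, ovr_single_comm hkr]
    · simp only [replace, Option.map_eq_some_iff] at h
      obtain ⟨r', hr', rfl⟩ := h
      simp only [Map, ihr hp hr' hbst.2.1, ovr_assoc]

end ScopeLogicBST

theorem plug_new_node (t : T) (p : List Dir) (k : ℤ)
    (hbst : isBST t) (hp : subtree t p = some T.leaf)
    (hins : insertableAt t p k) :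
    ∀ d : ℤ, ∃ t', replace t p (T.node .leaf .leaf k d) = some t' ∧
      isBST t' ∧ Map t' = Map t † single k d := by
  intro d
  obtain ⟨t', ht', hbst'⟩ := hins.2 d
  exact ⟨t', ht', hbst', Map_of_replace_leaf hp ht' hbst'⟩
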